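/- Let (S, T) have a min-stable distribution with unit exponential margins and Pickands dependence function A. Then H_{1,1}(1,0) = Cov(S·log S, log T) = ∫₀¹ [(1 − A(w))·(log w + ψ(2)) − log A(w)]/((1−w)·A(w)) dw. -/

import Mathlib

open MeasureTheory Real Filter

/-- A bound for the squared logarithm by powers. -/
lemma sq_log_le {x : ℝ} (hx : 0 < x) :
    Real.log x ^ 2 ≤ 2 * x ^ (2 : ℝ) + 32 * x ^ (-(1 / 2) : ℝ) := by
  have h1 : Real.log x ≤ x := (Real.log_le_sub_one_of_pos hx).trans (by linarith)
  have h2 : -Real.log x ≤ 4 * x ^ (-(1 / 4) : ℝ) := by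
    have := Real.log_le_rpow_div (inv_pos.2 hx).le (show (0 : ℝ) < 1 / 4 by norm_num)
    rw [Real.log_inv, Real.inv_rpow hx.le, ← Real.rpow_neg hx.le] at this
    linarith
  have h3 : (x ^ (-(1 / 4) : ℝ)) ^ 2 = x ^ (-(1 / 2) : ℝ) := by
    rw [← Real.rpow_natCast, ← Real.rpow_mul hx.le]; norm_num
  rw [← h3, Real.rpow_two]
  have h4 : 0 ≤ x ^ (-(1 / 4) : ℝ) := by positivity
  set z := x ^ (-(1 / 4) : ℝ)
  rcases le_total 0 (Real.log x) with h | h <;> nlinarith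

lemma integrableOn_sq_log_mul_exp :
    IntegrableOn (fun x => Real.log x ^ 2 * Real.exp (-x)) (Set.Ioi 0) := by
  have h1 := Real.GammaIntegral_convergent (show (0 : ℝ) < 3 by norm_num)
  have h2 := Real.GammaIntegral_convergent (show (0 : ℝ) < 1 / 2 by norm_num)
  refine Integrable.mono' ((h1.const_mul 2).add (h2.const_mul 32))
    (by fun_prop) ?_
  filter_upwards [ae_restrict_mem measurableSet_Ioi] with x hx
  rw [Real.norm_of_nonneg (by positivity)]
  have := mul_le_mul_of_nonneg_right (sq_log_le hx) (Real.exp_pos (-x)).le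
  refine this.trans (le_of_eq ?_)
  norm_num
  ring

lemma integrableOn_abs_log_mul_exp :
    IntegrableOn (fun x => |Real.log x| * Real.exp (-x)) (Set.Ioi 0) := by
  have h1 := Real.GammaIntegral_convergent (show (0 : ℝ) < 1 by norm_num)
  refine Integrable.mono' (h1.add integrableOn_sq_log_mul_exp) (by fun_prop) ?_
  filter_upwards [ae_restrict_mem measurableSet_Ioi] with x hx
  rw [Real.norm_of_nonneg (by positivity)]
  have : |Real.log x| ≤ 1 + Real.log x ^ 2 := by
    rw [← sq_abs]; nlinarith [sq_nonneg (|Real.log x| - 1)]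
  have := mul_le_mul_of_nonneg_right this (Real.exp_pos (-x)).le
  refine this.trans (le_of_eq ?_)
  norm_num
  ring

lemma integrableOn_log_mul_exp :
    IntegrableOn (fun x => Real.log x * Real.exp (-x)) (Set.Ioi 0) := by
  refine Integrable.mono' integrableOn_abs_log_mul_exp (by fun_prop) (ae_of_all _ fun x => ?_)
  simp

lemma integral_log_mul_exp :
    ∫ x in Set.Ioi (0 : ℝ), Real.log x * Real.exp (-x) = -Real.eulerMascheroniConstant := by
  have h := Complex.hasDerivAt_GammaIntegral (s := 1) (by simp)
  have h2 : Complex.Gamma =ᶠ[nhds 1] Complex.GammaIntegral := by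
    have : {s : ℂ | 0 < s.re} ∈ nhds (1 : ℂ) :=
      (isOpen_lt continuous_const Complex.continuous_re).mem_nhds (by simp)
    filter_upwards [this] with s hs using Complex.Gamma_eq_integral hs
  have h3 := (h.congr_of_eventuallyEq h2).unique Complex.hasDerivAt_Gamma_one
  simp only [sub_self, Complex.cpow_zero, one_mul] at h3
  simp only [← Complex.ofReal_mul] at h3
  rw [integral_complex_ofReal] at h3
  exact_mod_cast h3

lemma integrableOn_log_mul_exp_mul {a : ℝ} (ha : 0 < a) :
    IntegrableOn (fun x => Real.log x * Real.exp (-(a * x))) (Set.Ioi 0) := by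
  have h1 : IntegrableOn (fun x => Real.log (a * x) * Real.exp (-(a * x))) (Set.Ioi 0) := by
    have := (integrableOn_Ioi_comp_mul_left_iff
      (fun x => Real.log x * Real.exp (-x)) 0 ha).2 (by simpa using integrableOn_log_mul_exp)
    exact this
  have h2 : IntegrableOn (fun x => Real.exp (-a * x)) (Set.Ioi 0) :=
    integrableOn_exp_mul_Ioi (by linarith) 0
  refine (h1.sub (h2.const_mul (Real.log a))).congr ?_
  filter_upwards [ae_restrict_mem measurableSet_Ioi] with x hx
  simp only [Pi.sub_apply]
  rw [Real.log_mul ha.ne' (ne_of_gt hx)]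
  ring_nf

lemma integral_log_mul_exp_mul {a : ℝ} (ha : 0 < a) :
    ∫ x in Set.Ioi (0 : ℝ), Real.log x * Real.exp (-(a * x))
      = (-Real.eulerMascheroniConstant - Real.log a) / a := by
  have h1 := integral_comp_mul_left_Ioi (fun x => Real.log x * Real.exp (-x)) 0 ha
  simp only [mul_zero, integral_log_mul_exp, smul_eq_mul] at h1
  have h2 : IntegrableOn (fun x => Real.exp (-a * x)) (Set.Ioi 0) :=
    integrableOn_exp_mul_Ioi (by linarith) 0
  have h3 : ∫ x in Set.Ioi (0 : ℝ), Real.log (a * x) * Real.exp (-(a * x))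
      = ∫ x in Set.Ioi (0 : ℝ),
        (Real.log x * Real.exp (-(a * x)) + Real.log a * Real.exp (-a * x)) := by
    refine setIntegral_congr_fun measurableSet_Ioi fun x hx => ?_
    rw [Real.log_mul ha.ne' (ne_of_gt hx)]
    ring_nf
  rw [h3, integral_add (integrableOn_log_mul_exp_mul ha) (h2.const_mul _),
    integral_const_mul, integral_exp_mul_Ioi (by linarith)] at h1
  simp only [mul_zero, Real.exp_zero] at h1
  field_simp at h1 ⊢
  linarith

/-- The radial integral obtained after passing to polar coordinates. -/
lemma integral_log_add_mul_exp_sub {a c : ℝ} (ha : 0 < a) :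
    ∫ r in Set.Ioi (0 : ℝ), (Real.log r + c) * (Real.exp (-(r * a)) - Real.exp (-r))
      = ((1 - a) * (c - Real.eulerMascheroniConstant) - Real.log a) / a := by
  have key : ∀ b : ℝ, 0 < b →
      IntegrableOn (fun r => (Real.log r + c) * Real.exp (-(b * r))) (Set.Ioi 0) ∧
      ∫ r in Set.Ioi (0 : ℝ), (Real.log r + c) * Real.exp (-(b * r))
        = (-Real.eulerMascheroniConstant - Real.log b + c) / b := by
    intro b hb
    have h2 : IntegrableOn (fun x => Real.exp (-b * x)) (Set.Ioi 0) :=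
      integrableOn_exp_mul_Ioi (by linarith) 0
    have h3 : (fun r => (Real.log r + c) * Real.exp (-(b * r)))
        = fun r => Real.log r * Real.exp (-(b * r)) + c * Real.exp (-b * r) := by
      ext r; ring_nf
    rw [h3]
    refine ⟨(integrableOn_log_mul_exp_mul hb).add (h2.const_mul c), ?_⟩
    rw [integral_add (integrableOn_log_mul_exp_mul hb) (h2.const_mul _),
      integral_const_mul, integral_exp_mul_Ioi (by linarith), integral_log_mul_exp_mul hb]
    simp only [mul_zero, Real.exp_zero]
    field_simp
  have e : (fun r => (Real.log r + c) * (Real.exp (-(r * a)) - Real.exp (-r)))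
      = fun r => (Real.log r + c) * Real.exp (-(a * r))
        - (Real.log r + c) * Real.exp (-(1 * r)) := by
    ext r; ring_nf
  rw [e, integral_sub (key a ha).1 (key 1 one_pos).1, (key a ha).2, (key 1 one_pos).2]
  field_simp
  simp
  ring

lemma deriv_Gamma_two_div : deriv Real.Gamma 2 / Real.Gamma 2
    = 1 - Real.eulerMascheroniConstant := by
  have h := Real.deriv_Gamma_nat 1
  have e : ((1 : ℕ) : ℝ) + 1 = 2 := by norm_num
  rw [e] at h
  rw [h, Real.Gamma_two]
  simp [harmonic]
  ring

/-- The kernel whose integral against `u` is `∫ x in 1..s, u x`. -/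
noncomputable def stepDiff (s x : ℝ) : ℝ := (if x < s then 1 else 0) - (if x < 1 then 1 else 0)

lemma measurable_stepDiff : Measurable fun p : ℝ × ℝ => stepDiff p.1 p.2 := by
  unfold stepDiff
  refine (Measurable.ite (measurableSet_lt measurable_snd measurable_fst)
    measurable_const measurable_const).sub (Measurable.ite
    (measurableSet_lt measurable_snd measurable_const) measurable_const measurable_const)

lemma stepDiff_mul_eq (s : ℝ) (u : ℝ → ℝ) : (fun x => stepDiff s x * u x)
    = fun x => (Set.Ico 1 s).indicator u x - (Set.Ico s 1).indicator u x := by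
  ext x
  simp only [stepDiff, Set.indicator, Set.mem_Ico]
  grind

lemma abs_stepDiff_mul_eq (s : ℝ) (u : ℝ → ℝ) : (fun x => |stepDiff s x * u x|)
    = fun x => (Set.Ico 1 s).indicator (fun y => |u y|) x
      + (Set.Ico s 1).indicator (fun y => |u y|) x := by
  ext x
  simp only [stepDiff, Set.indicator, Set.mem_Ico]
  split_ifs <;> first | (simp; done) | grind

lemma integrable_stepDiff_mul {s : ℝ} {u : ℝ → ℝ}
    (hu : IntervalIntegrable u volume 1 s) : Integrable fun x => stepDiff s x * u x := by
  rw [stepDiff_mul_eq]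
  rw [intervalIntegrable_iff'] at hu
  refine Integrable.sub ?_ ?_ <;> rw [integrable_indicator_iff measurableSet_Ico] <;>
    refine hu.mono_set fun x hx => ?_
  · exact ⟨(min_le_left _ _).trans hx.1, hx.2.le.trans (le_max_right _ _)⟩
  · exact ⟨(min_le_right _ _).trans hx.1, hx.2.le.trans (le_max_left _ _)⟩

lemma integral_stepDiff_mul {s : ℝ} {u : ℝ → ℝ}
    (hu : IntervalIntegrable u volume 1 s) :
    ∫ x, stepDiff s x * u x = ∫ x in (1 : ℝ)..s, u x := by
  rw [stepDiff_mul_eq]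
  rw [intervalIntegrable_iff'] at hu
  rw [integral_sub, integral_indicator measurableSet_Ico, integral_indicator measurableSet_Ico,
    integral_Ico_eq_integral_Ioc, integral_Ico_eq_integral_Ioc, intervalIntegral]
  all_goals rw [integrable_indicator_iff measurableSet_Ico]; refine hu.mono_set fun x hx => ?_
  · exact ⟨(min_le_left _ _).trans hx.1, hx.2.le.trans (le_max_right _ _)⟩
  · exact ⟨(min_le_right _ _).trans hx.1, hx.2.le.trans (le_max_left _ _)⟩

lemma integral_abs_stepDiff_mul {s : ℝ} {u : ℝ → ℝ}
    (hu : IntervalIntegrable u volume 1 s) :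
    ∫ x, |stepDiff s x * u x| = |(∫ x in (1 : ℝ)..s, |u x|)| := by
  rcases le_total 1 s with h | h
  · have e : (fun x => |stepDiff s x * u x|) = fun x => stepDiff s x * |u x| := by
      rw [abs_stepDiff_mul_eq, stepDiff_mul_eq, Set.Ico_eq_empty (not_lt.2 h)]
      simp
    rw [e, integral_stepDiff_mul hu.abs, abs_of_nonneg]
    exact intervalIntegral.integral_nonneg h fun x _ => abs_nonneg _
  · have e : (fun x => |stepDiff s x * u x|) = fun x => -(stepDiff s x * |u x|) := by
      have := congrFun (stepDiff_mul_eq s fun x => |u x|)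
      rw [abs_stepDiff_mul_eq]
      ext x
      rw [this, Set.Ico_eq_empty (not_lt.2 h)]
      simp
    rw [e, integral_neg, integral_stepDiff_mul hu.abs, intervalIntegral.integral_symm, neg_neg,
      abs_neg, abs_of_nonneg]
    exact intervalIntegral.integral_nonneg h fun x _ => abs_nonneg _

lemma intervalIntegrable_log_add_one (s : ℝ) :
    IntervalIntegrable (fun x => Real.log x + 1) volume 1 s :=
  intervalIntegral.intervalIntegrable_log'.add intervalIntegrable_const

lemma intervalIntegrable_inv_of_pos {s : ℝ} (hs : 0 < s) :
    IntervalIntegrable (fun x : ℝ => x⁻¹) volume 1 s := by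
  refine intervalIntegral.intervalIntegrable_inv (fun x hx => ?_) continuousOn_id
  have : 0 < x := lt_of_lt_of_le (lt_min one_pos hs) hx.1
  exact this.ne'

lemma integral_stepDiff_mul_log_add_one (s : ℝ) :
    ∫ x, stepDiff s x * (Real.log x + 1) = s * Real.log s := by
  rw [integral_stepDiff_mul (intervalIntegrable_log_add_one s),
    intervalIntegral.integral_add intervalIntegral.intervalIntegrable_log'
      intervalIntegrable_const]
  simp

lemma integral_stepDiff_mul_inv {s : ℝ} (hs : 0 < s) :
    ∫ x, stepDiff s x * x⁻¹ = Real.log s := by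
  rw [integral_stepDiff_mul (intervalIntegrable_inv_of_pos hs), integral_inv_of_pos one_pos hs]
  simp

lemma integral_abs_stepDiff_mul_inv {s : ℝ} (hs : 0 < s) :
    ∫ x, |stepDiff s x * x⁻¹| = |Real.log s| := by
  rw [integral_abs_stepDiff_mul (intervalIntegrable_inv_of_pos hs)]
  have : ∫ x in (1 : ℝ)..s, |x⁻¹| = ∫ x in (1 : ℝ)..s, x⁻¹ := by
    refine intervalIntegral.integral_congr fun x hx => ?_
    have : 0 < x := lt_of_lt_of_le (lt_min one_pos hs) hx.1
    rw [abs_of_pos (inv_pos.2 this)]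
  rw [this, integral_inv_of_pos one_pos hs, div_one]

lemma integral_abs_stepDiff_mul_log_add_one_le {s : ℝ} (hs : 0 < s) :
    ∫ x, |stepDiff s x * (Real.log x + 1)| ≤ 2 + s ^ 2 := by
  rw [integral_abs_stepDiff_mul (intervalIntegrable_log_add_one s)]
  have hi := intervalIntegrable_log_add_one s
  rcases le_total 1 s with h | h
  · rw [abs_of_nonneg (intervalIntegral.integral_nonneg h fun x _ => abs_nonneg _)]
    have : ∫ x in (1 : ℝ)..s, |Real.log x + 1| = ∫ x in (1 : ℝ)..s, (Real.log x + 1) := by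
      refine intervalIntegral.integral_congr fun x hx => ?_
      rw [Set.uIcc_of_le h] at hx
      have := Real.log_nonneg hx.1
      rw [abs_of_nonneg (by linarith)]
    rw [this, intervalIntegral.integral_add intervalIntegral.intervalIntegrable_log'
      intervalIntegrable_const]
    simp
    nlinarith [Real.log_le_sub_one_of_pos hs]
  · rw [intervalIntegral.integral_symm, abs_neg,
      abs_of_nonneg (intervalIntegral.integral_nonneg h fun x _ => abs_nonneg _)]
    have : ∫ x in s..1, |Real.log x + 1| ≤ ∫ x in s..1, (1 - Real.log x) := by
      refine intervalIntegral.integral_mono_on h hi.abs.symm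
        (intervalIntegrable_const.sub intervalIntegral.intervalIntegrable_log') fun x hx => ?_
      have := Real.log_nonpos (hs.le.trans hx.1) hx.2
      exact abs_le.2 ⟨by linarith, by linarith⟩
    refine this.trans ?_
    rw [intervalIntegral.integral_sub intervalIntegrable_const
      intervalIntegral.intervalIntegrable_log']
    simp
    nlinarith [mul_nonpos_of_nonneg_of_nonpos hs.le (Real.log_nonpos hs.le h)]

section Hoeffding

variable {Ω : Type*} [MeasurableSpace Ω] {μ : Measure Ω} [IsProbabilityMeasure μ]

/-- The covariance of two integrated random fields is the integral of the covariance field. -/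
lemma integral_mul_sub_integral_mul_integral {U V : Ω → ℝ → ℝ}
    (hU : Measurable (Function.uncurry U)) (hV : Measurable (Function.uncurry V))
    (hUi : ∀ᵐ ω ∂μ, Integrable (U ω)) (hVi : ∀ᵐ ω ∂μ, Integrable (V ω))
    (hUn : Integrable (fun ω => ∫ x, |U ω x|) μ) (hVn : Integrable (fun ω => ∫ x, |V ω x|) μ)
    (hUVn : Integrable (fun ω => (∫ x, |U ω x|) * ∫ x, |V ω x|) μ) :
    Integrable (fun p : ℝ × ℝ =>
      (∫ ω, U ω p.1 * V ω p.2 ∂μ) - (∫ ω, U ω p.1 ∂μ) * ∫ ω, V ω p.2 ∂μ) ∧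
    (∫ ω, (∫ x, U ω x) * (∫ x, V ω x) ∂μ) - (∫ ω, (∫ x, U ω x) ∂μ) * (∫ ω, (∫ x, V ω x) ∂μ)
      = ∫ p : ℝ × ℝ,
        ((∫ ω, U ω p.1 * V ω p.2 ∂μ) - (∫ ω, U ω p.1 ∂μ) * ∫ ω, V ω p.2 ∂μ) := by
  have iU : Integrable (Function.uncurry U) (μ.prod volume) :=
    (integrable_prod_iff hU.aestronglyMeasurable).2 ⟨hUi, hUn⟩
  have iV : Integrable (Function.uncurry V) (μ.prod volume) :=
    (integrable_prod_iff hV.aestronglyMeasurable).2 ⟨hVi, hVn⟩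
  have mUV : Measurable (Function.uncurry fun ω (p : ℝ × ℝ) => U ω p.1 * V ω p.2) :=
    (hU.comp (measurable_fst.prodMk (measurable_fst.comp measurable_snd))).mul
      (hV.comp (measurable_fst.prodMk (measurable_snd.comp measurable_snd)))
  have iUV : Integrable (Function.uncurry fun ω (p : ℝ × ℝ) => U ω p.1 * V ω p.2)
      (μ.prod volume) := by
    refine (integrable_prod_iff mUV.aestronglyMeasurable).2 ⟨?_, ?_⟩
    · filter_upwards [hUi, hVi] with ω h1 h2 using h1.mul_prod h2
    · refine hUVn.congr (ae_of_all _ fun ω => ?_)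
      simp only [Function.uncurry, norm_mul, Real.norm_eq_abs]
      exact (integral_prod_mul (fun x => |U ω x|) (fun x => |V ω x|)).symm
  have jU : Integrable (fun x => ∫ ω, U ω x ∂μ) := iU.integral_prod_right
  have jV : Integrable (fun x => ∫ ω, V ω x ∂μ) := iV.integral_prod_right
  have jUV : Integrable (fun p : ℝ × ℝ => ∫ ω, U ω p.1 * V ω p.2 ∂μ) := iUV.integral_prod_right
  refine ⟨jUV.sub (jU.mul_prod jV), ?_⟩
  rw [integral_sub jUV (jU.mul_prod jV), integral_integral_swap iU, integral_integral_swap iV,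
    ← integral_integral_swap iUV]
  congr 1
  · refine integral_congr_ae (ae_of_all _ fun ω => ?_)
    exact (integral_prod_mul (U ω) (V ω)).symm
  · exact (integral_prod_mul (fun x => ∫ ω, U ω x ∂μ) (fun x => ∫ ω, V ω x ∂μ)).symm

lemma map_eq_expMeasure {S : Ω → ℝ} (hS : Measurable S) (hpos : ∀ᵐ ω ∂μ, 0 < S ω)
    (hsurv : ∀ x, 0 < x → μ.real {ω | x < S ω} = Real.exp (-x)) :
    μ.map S = ProbabilityTheory.expMeasure 1 := by
  have : IsProbabilityMeasure (μ.map S) := Measure.isProbabilityMeasure_map hS.aemeasurable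
  have := ProbabilityTheory.isProbabilityMeasure_expMeasure (r := 1) one_pos
  refine Measure.eq_of_cdf _ _ ?_
  ext x
  rw [ProbabilityTheory.cdf_expMeasure_eq one_pos, ProbabilityTheory.cdf_eq_real,
    map_measureReal_apply hS measurableSet_Iic]
  rcases lt_or_ge 0 x with hx | hx
  · have e : S ⁻¹' Set.Iic x = {ω | x < S ω}ᶜ := by ext; simp
    rw [e, probReal_compl_eq_one_sub (measurableSet_lt measurable_const hS), hsurv x hx,
      if_pos hx.le, one_mul]
  · have e : μ.real (S ⁻¹' Set.Iic x) = 0 := by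
      rw [measureReal_def, measure_eq_zero_iff_ae_notMem.2, ENNReal.toReal_zero]
      filter_upwards [hpos] with ω h h'
      exact (h.trans_le (h'.trans hx)).false
    rw [e]
    split_ifs with h
    · rw [le_antisymm hx h]; simp
    · rfl

lemma integrable_comp_of_map_eq_expMeasure {Ω : Type*} [MeasurableSpace Ω] {μ : Measure Ω}
    {S : Ω → ℝ} (hS : Measurable S)
    (hlaw : μ.map S = ProbabilityTheory.expMeasure 1) {g : ℝ → ℝ} (hg : Measurable g)
    (hi : IntegrableOn (fun x => g x * Real.exp (-x)) (Set.Ioi 0)) :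
    Integrable (fun ω => g (S ω)) μ := by
  refine (integrable_map_measure hg.aestronglyMeasurable hS.aemeasurable).1 ?_
  rw [hlaw, ProbabilityTheory.expMeasure, ProbabilityTheory.gammaMeasure,
    integrable_withDensity_iff (f := ProbabilityTheory.gammaPDF 1 1)
      (ProbabilityTheory.measurable_gammaPDFReal 1 1).ennreal_ofReal
      (ae_of_all _ fun _ => ENNReal.ofReal_lt_top)]
  rw [← integrableOn_Ici_iff_integrableOn_Ioi, ← integrable_indicator_iff measurableSet_Ici] at hi
  refine hi.congr (ae_of_all _ fun x => ?_)
  by_cases hx : 0 ≤ x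
  · simp [Set.indicator, ProbabilityTheory.gammaPDF, ProbabilityTheory.gammaPDFReal, hx,
      ENNReal.toReal_ofReal, Real.exp_nonneg]
  · simp [Set.indicator, ProbabilityTheory.gammaPDF, ProbabilityTheory.gammaPDFReal, hx]

lemma integral_stepDiff_mul_sub {S T : Ω → ℝ} (hS : Measurable S) (hT : Measurable T) (x y : ℝ) :
    (∫ ω, stepDiff (S ω) x * stepDiff (T ω) y ∂μ)
      - (∫ ω, stepDiff (S ω) x ∂μ) * (∫ ω, stepDiff (T ω) y ∂μ)
      = μ.real {ω | x < S ω ∧ y < T ω} - μ.real {ω | x < S ω} * μ.real {ω | y < T ω} := by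
  have mS : MeasurableSet {ω | x < S ω} := measurableSet_lt measurable_const hS
  have mT : MeasurableSet {ω | y < T ω} := measurableSet_lt measurable_const hT
  have mST : MeasurableSet {ω | x < S ω ∧ y < T ω} := mS.inter mT
  set a : ℝ := if x < 1 then 1 else 0
  set b : ℝ := if y < 1 then 1 else 0
  have iS : Integrable ({ω | x < S ω}.indicator (1 : Ω → ℝ)) μ :=
    (integrable_const 1).indicator mS
  have iT : Integrable ({ω | y < T ω}.indicator (1 : Ω → ℝ)) μ :=
    (integrable_const 1).indicator mT
  have iST : Integrable ({ω | x < S ω ∧ y < T ω}.indicator (1 : Ω → ℝ)) μ :=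
    (integrable_const 1).indicator mST
  have e1 : (fun ω => stepDiff (S ω) x) = fun ω => {ω | x < S ω}.indicator (1 : Ω → ℝ) ω - a := by
    ext ω; simp [stepDiff, Set.indicator, a]
  have e2 : (fun ω => stepDiff (T ω) y) = fun ω => {ω | y < T ω}.indicator (1 : Ω → ℝ) ω - b := by
    ext ω; simp [stepDiff, Set.indicator, b]
  have e3 : (fun ω => stepDiff (S ω) x * stepDiff (T ω) y)
      = fun ω => {ω | x < S ω ∧ y < T ω}.indicator (1 : Ω → ℝ) ω
        - b * {ω | x < S ω}.indicator (1 : Ω → ℝ) ω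
        - a * {ω | y < T ω}.indicator (1 : Ω → ℝ) ω + a * b := by
    ext ω
    rw [congrFun e1 ω, congrFun e2 ω]
    by_cases h1 : x < S ω <;> by_cases h2 : y < T ω <;> simp [Set.indicator, h1, h2] <;> ring
  have i1 : Integrable (fun ω => {ω | x < S ω ∧ y < T ω}.indicator (1 : Ω → ℝ) ω
      - b * {ω | x < S ω}.indicator (1 : Ω → ℝ) ω) μ := iST.sub (iS.const_mul b)
  have i2 : Integrable (fun ω => {ω | x < S ω ∧ y < T ω}.indicator (1 : Ω → ℝ) ω
      - b * {ω | x < S ω}.indicator (1 : Ω → ℝ) ω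
      - a * {ω | y < T ω}.indicator (1 : Ω → ℝ) ω) μ := i1.sub (iT.const_mul a)
  rw [e1, e2, e3, integral_add i2 (integrable_const _), integral_sub i1 (iT.const_mul a),
    integral_sub iST (iS.const_mul b), integral_sub iS (integrable_const _),
    integral_sub iT (integrable_const _), integral_const_mul, integral_const_mul,
    integral_indicator_one mS, integral_indicator_one mT, integral_indicator_one mST]
  simp
  ring

/-- Hoeffding's covariance formula for `S log S` and `log T`, for exponential margins. -/
lemma cov_mul_log_log_eq_integral {S T : Ω → ℝ} (hS : Measurable S) (hT : Measurable T)
    (hSpos : ∀ᵐ ω ∂μ, 0 < S ω) (hTpos : ∀ᵐ ω ∂μ, 0 < T ω)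
    (hSlaw : μ.map S = ProbabilityTheory.expMeasure 1)
    (hTlaw : μ.map T = ProbabilityTheory.expMeasure 1) :
    Integrable (fun p : ℝ × ℝ => (Real.log p.1 + 1) * p.2⁻¹ *
      (μ.real {ω | p.1 < S ω ∧ p.2 < T ω} - μ.real {ω | p.1 < S ω} * μ.real {ω | p.2 < T ω})) ∧
    (∫ ω, (S ω * Real.log (S ω)) * Real.log (T ω) ∂μ)
        - (∫ ω, S ω * Real.log (S ω) ∂μ) * (∫ ω, Real.log (T ω) ∂μ)
      = ∫ p : ℝ × ℝ, (Real.log p.1 + 1) * p.2⁻¹ *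
        (μ.real {ω | p.1 < S ω ∧ p.2 < T ω} - μ.real {ω | p.1 < S ω} * μ.real {ω | p.2 < T ω}) := by
  set U : Ω → ℝ → ℝ := fun ω x => stepDiff (S ω) x * (Real.log x + 1)
  set V : Ω → ℝ → ℝ := fun ω x => stepDiff (T ω) x * x⁻¹
  have hU : Measurable (Function.uncurry U) :=
    (measurable_stepDiff.comp ((hS.comp measurable_fst).prodMk measurable_snd)).mul (by fun_prop)
  have hV : Measurable (Function.uncurry V) :=
    (measurable_stepDiff.comp ((hT.comp measurable_fst).prodMk measurable_snd)).mul (by fun_prop)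
  have iS2 : Integrable (fun ω => 2 + S ω ^ 2) μ := by
    refine integrable_comp_of_map_eq_expMeasure (g := fun x => 2 + x ^ 2) hS hSlaw
      (by fun_prop) ?_
    refine (((Real.GammaIntegral_convergent (show (0 : ℝ) < 1 by norm_num)).const_mul 2).add
      (Real.GammaIntegral_convergent (show (0 : ℝ) < 3 by norm_num))).congr
      (ae_of_all _ fun x => ?_)
    norm_num
    ring
  have iS4 : Integrable (fun ω => (2 + S ω ^ 2) ^ 2) μ := by
    refine integrable_comp_of_map_eq_expMeasure (g := fun x => (2 + x ^ 2) ^ 2) hS hSlaw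
      (by fun_prop) ?_
    refine ((((Real.GammaIntegral_convergent (show (0 : ℝ) < 1 by norm_num)).const_mul 4).add
      ((Real.GammaIntegral_convergent (show (0 : ℝ) < 3 by norm_num)).const_mul 4)).add
      (Real.GammaIntegral_convergent (show (0 : ℝ) < 5 by norm_num))).congr
      (ae_of_all _ fun x => ?_)
    have : x ^ (4 : ℝ) = x ^ 4 := by exact_mod_cast Real.rpow_natCast x 4
    norm_num [this]
    ring
  have iT1 : Integrable (fun ω => |Real.log (T ω)|) μ :=
    integrable_comp_of_map_eq_expMeasure (g := fun x => |Real.log x|) hT hTlaw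
      (by fun_prop) integrableOn_abs_log_mul_exp
  have iT2 : Integrable (fun ω => Real.log (T ω) ^ 2) μ :=
    integrable_comp_of_map_eq_expMeasure (g := fun x => Real.log x ^ 2) hT hTlaw
      (by fun_prop) integrableOn_sq_log_mul_exp
  have hUle : ∀ᵐ ω ∂μ, ∫ x, |U ω x| ≤ 2 + S ω ^ 2 := by
    filter_upwards [hSpos] with ω h using integral_abs_stepDiff_mul_log_add_one_le h
  have hVeq : ∀ᵐ ω ∂μ, ∫ x, |V ω x| = |Real.log (T ω)| := by
    filter_upwards [hTpos] with ω h using integral_abs_stepDiff_mul_inv h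
  have mUn : AEStronglyMeasurable (fun ω => ∫ x, |U ω x|) μ :=
    (hU.norm.stronglyMeasurable.integral_prod_right').aestronglyMeasurable
  have mVn : AEStronglyMeasurable (fun ω => ∫ x, |V ω x|) μ :=
    (hV.norm.stronglyMeasurable.integral_prod_right').aestronglyMeasurable
  have nU : ∀ ω, 0 ≤ ∫ x, |U ω x| := fun ω => integral_nonneg fun x => abs_nonneg _
  have key := integral_mul_sub_integral_mul_integral (μ := μ) hU hV
    (ae_of_all _ fun ω => integrable_stepDiff_mul (intervalIntegrable_log_add_one _))
    (hTpos.mono fun ω h => integrable_stepDiff_mul (intervalIntegrable_inv_of_pos h))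
    (iS2.mono' mUn (by
      filter_upwards [hUle] with ω h
      rwa [Real.norm_of_nonneg (nU ω)]))
    (iT1.congr (hVeq.mono fun ω h => h.symm))
    ((iS4.add iT2).mono' (mUn.mul mVn) (by
      filter_upwards [hUle, hVeq] with ω h h'
      rw [h', Real.norm_of_nonneg (mul_nonneg (nU ω) (abs_nonneg _)), Pi.add_apply,
        ← sq_abs (Real.log (T ω))]
      nlinarith [mul_le_mul_of_nonneg_right h (abs_nonneg (Real.log (T ω))), nU ω,
        sq_nonneg (2 + S ω ^ 2 - |Real.log (T ω)|), abs_nonneg (Real.log (T ω))]))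
  have e : (fun p : ℝ × ℝ =>
      (∫ ω, U ω p.1 * V ω p.2 ∂μ) - (∫ ω, U ω p.1 ∂μ) * ∫ ω, V ω p.2 ∂μ)
      = fun p : ℝ × ℝ => (Real.log p.1 + 1) * p.2⁻¹ *
      (μ.real {ω | p.1 < S ω ∧ p.2 < T ω} - μ.real {ω | p.1 < S ω} * μ.real {ω | p.2 < T ω}) := by
    ext p
    rw [← integral_stepDiff_mul_sub hS hT]
    have : ∀ ω, U ω p.1 * V ω p.2 = ((Real.log p.1 + 1) * p.2⁻¹) *
        (stepDiff (S ω) p.1 * stepDiff (T ω) p.2) := fun ω => by simp only [U, V]; ring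
    simp only [this, integral_const_mul]
    simp only [U, V, integral_mul_const]
    ring
  have h1 : ∀ ω, ∫ x, U ω x = S ω * Real.log (S ω) := fun ω =>
    integral_stepDiff_mul_log_add_one _
  have h2 : ∀ᵐ ω ∂μ, ∫ x, V ω x = Real.log (T ω) :=
    hTpos.mono fun ω h => integral_stepDiff_mul_inv h
  rw [e] at key
  refine ⟨key.1, ?_⟩
  rw [← key.2]
  simp only [h1]
  have h3 : ∫ ω, S ω * Real.log (S ω) * (∫ x, V ω x) ∂μ
      = ∫ ω, S ω * Real.log (S ω) * Real.log (T ω) ∂μ :=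
    integral_congr_ae (h2.mono fun ω h => by simp only [h])
  rw [integral_congr_ae h2, h3]

end Hoeffding

/-- Integration over the open first quadrant in the coordinates `(x + y, x / (x + y))`. -/
lemma integral_eq_integral_radial {h : ℝ × ℝ → ℝ} (hi : Integrable h)
    (h0 : ∀ p : ℝ × ℝ, ¬(0 < p.1 ∧ 0 < p.2) → h p = 0) :
    ∫ p, h p = ∫ r in Set.Ioi (0 : ℝ), ∫ w in Set.Ioo (0 : ℝ) 1, r * h (r * w, r * (1 - w)) := by
  have mp := measurePreserving_prod_neg_add (volume : Measure ℝ) (volume : Measure ℝ)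
  have emb : MeasurableEmbedding fun z : ℝ × ℝ => (z.1, -z.1 + z.2) :=
    (MeasurableEquiv.shearAddRight ℝ).symm.measurableEmbedding
  have hi' : Integrable (fun z : ℝ × ℝ => h (z.1, -z.1 + z.2)) (volume.prod volume) :=
    (mp.integrable_comp_emb emb).2 hi
  have e1 : ∫ p, h p = ∫ r, ∫ x, h (x, -x + r) := by
    rw [← integral_prod_symm _ hi']
    exact (mp.integral_comp emb h).symm
  rw [e1, ← integral_indicator measurableSet_Ioi]
  congr 1
  ext r
  by_cases hr : 0 < r
  · rw [Set.indicator_of_mem (Set.mem_Ioi.2 hr), integral_const_mul]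
    have := Measure.integral_comp_mul_left (fun x => h (x, -x + r)) r
    rw [abs_of_pos (inv_pos.2 hr), smul_eq_mul, eq_inv_mul_iff_mul_eq₀ hr.ne'] at this
    rw [← this, ← integral_indicator measurableSet_Ioo]
    congr 2
    ext w
    by_cases hw : w ∈ Set.Ioo (0 : ℝ) 1
    · rw [Set.indicator_of_mem hw]
      ring_nf
    · rw [Set.indicator_of_notMem hw]
      refine h0 _ fun hh => hw ?_
      obtain ⟨ha, hb⟩ := hh
      simp only at ha hb
      exact ⟨pos_of_mul_pos_right ha hr.le, by nlinarith⟩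
  · rw [Set.indicator_of_notMem (mt Set.mem_Ioi.1 hr)]
    refine integral_eq_zero_of_ae (ae_of_all _ fun x => h0 _ fun hh => hr ?_)
    obtain ⟨ha, hb⟩ := hh
    simp only at ha hb
    linarith

lemma exp_sub_exp_le {r a : ℝ} (hr : 0 ≤ r) (ha : 1 / 2 ≤ a) (ha1 : a ≤ 1) :
    Real.exp (-(r * a)) - Real.exp (-r) ≤ (1 - a) * (r * Real.exp (-(1 / 2 * r))) := by
  have h1 : Real.exp (-r) = Real.exp (-(r * a)) * Real.exp (-(r * (1 - a))) := by
    rw [← Real.exp_add]; ring_nf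
  have h2 := Real.add_one_le_exp (-(r * (1 - a)))
  have h3 : Real.exp (-(r * a)) ≤ Real.exp (-(1 / 2 * r)) := Real.exp_le_exp.2 (by nlinarith)
  have h4 := Real.exp_pos (-(r * a))
  have h5 : 0 ≤ r * (1 - a) := mul_nonneg hr (by linarith)
  rw [h1]
  nlinarith [mul_le_mul_of_nonneg_left h2 h4.le, mul_le_mul_of_nonneg_right h3 h5]

lemma exp_le_exp_neg_mul {r a : ℝ} (hr : 0 ≤ r) (ha1 : a ≤ 1) :
    Real.exp (-r) ≤ Real.exp (-(r * a)) := Real.exp_le_exp.2 (by nlinarith)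

lemma integrable_radial {A : ℝ → ℝ} (hA : ContinuousOn A (Set.Ioo 0 1))
    (hAbound : ∀ w ∈ Set.Icc (0:ℝ) 1, max w (1 - w) ≤ A w ∧ A w ≤ 1) :
    Integrable (fun p : ℝ × ℝ => (Real.log p.1 + (Real.log p.2 + 1)) * (1 - p.2)⁻¹ *
        (Real.exp (-(p.1 * A p.2)) - Real.exp (-p.1)))
      ((volume.restrict (Set.Ioi 0)).prod (volume.restrict (Set.Ioo 0 1))) := by
  have hAm : AEStronglyMeasurable A (volume.restrict (Set.Ioo 0 1)) :=
    hA.aestronglyMeasurable measurableSet_Ioo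
  have hexp : IntegrableOn (fun r : ℝ => r * Real.exp (-(1 / 2 * r))) (Set.Ioi 0) := by
    have := integrableOn_rpow_mul_exp_neg_mul_rpow (s := 1) (p := 1) (b := 1 / 2) (by norm_num)
      one_pos (by norm_num)
    refine this.congr (ae_of_all _ fun x => ?_)
    norm_num
  have hlogexp : IntegrableOn (fun r : ℝ => |Real.log r| * (r * Real.exp (-(1 / 2 * r))))
      (Set.Ioi 0) := by
    have h4 : IntegrableOn (fun r => |Real.log r * Real.exp (-(1 / 4 * r))|) (Set.Ioi 0) :=
      (integrableOn_log_mul_exp_mul (show (0 : ℝ) < 1 / 4 by norm_num)).abs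
    refine Integrable.mono' (h4.const_mul 4) (by fun_prop) ?_
    filter_upwards [ae_restrict_mem measurableSet_Ioi] with r hr
    have hr : 0 < r := hr
    rw [Real.norm_of_nonneg (by positivity), abs_mul, abs_of_pos (Real.exp_pos _)]
    have h1 : Real.exp (-(1 / 2 * r)) = Real.exp (-(1 / 4 * r)) * Real.exp (-(1 / 4 * r)) := by
      rw [← Real.exp_add]; ring_nf
    have h2 : r * Real.exp (-(1 / 4 * r)) ≤ 4 := by
      rw [Real.exp_neg, ← div_eq_mul_inv, div_le_iff₀ (Real.exp_pos _)]
      linarith [Real.add_one_le_exp (1 / 4 * r)]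
    have h3 : 0 ≤ |Real.log r| * Real.exp (-(1 / 4 * r)) := by positivity
    rw [h1]
    nlinarith [mul_le_mul_of_nonneg_left h2 h3]
  have hw : IntegrableOn (fun w : ℝ => |Real.log w| + 1) (Set.Ioo 0 1) := by
    have : IntervalIntegrable Real.log volume 0 1 := intervalIntegral.intervalIntegrable_log'
    rw [intervalIntegrable_iff_integrableOn_Ioo_of_le zero_le_one] at this
    exact this.abs.add (integrable_const 1)
  have hone : IntegrableOn (fun _ : ℝ => (1 : ℝ)) (Set.Ioo 0 1) := integrable_const 1
  refine Integrable.mono' ((hlogexp.mul_prod hone).add (hexp.mul_prod hw)) ?_ ?_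
  · have : AEStronglyMeasurable (fun p : ℝ × ℝ => A p.2)
      ((volume.restrict (Set.Ioi 0)).prod (volume.restrict (Set.Ioo 0 1))) := hAm.comp_snd
    have h2 : AEStronglyMeasurable (fun p : ℝ × ℝ => Real.exp (-(p.1 * A p.2)))
      ((volume.restrict (Set.Ioi 0)).prod (volume.restrict (Set.Ioo 0 1))) :=
      Real.continuous_exp.comp_aestronglyMeasurable
        ((continuous_fst.aestronglyMeasurable.mul this).neg)
    refine AEStronglyMeasurable.mul ?_ (h2.sub ?_)
    · exact Measurable.aestronglyMeasurable (by fun_prop)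
    · exact Measurable.aestronglyMeasurable (by fun_prop)
  · rw [Measure.prod_restrict]
    filter_upwards [ae_restrict_mem (measurableSet_Ioi.prod measurableSet_Ioo)] with p hp
    obtain ⟨hr, hw0, hw1⟩ := hp
    have hr : 0 < p.1 := hr
    obtain ⟨hb1, hb2⟩ := hAbound p.2 ⟨hw0.le, hw1.le⟩
    have hb3 := (le_max_left _ _).trans hb1
    have hb4 := (le_max_right _ _).trans hb1
    have hd := exp_sub_exp_le hr.le (show 1 / 2 ≤ A p.2 by linarith) hb2
    have hd0 := exp_le_exp_neg_mul hr.le hb2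
    have hw1' : 0 < 1 - p.2 := by linarith
    set E := p.1 * Real.exp (-(1 / 2 * p.1))
    have hE0 : 0 ≤ E := by positivity
    have hd2 : (1 - p.2)⁻¹ * (Real.exp (-(p.1 * A p.2)) - Real.exp (-p.1)) ≤ E := by
      rw [inv_mul_le_iff₀ hw1']
      exact hd.trans (mul_le_mul_of_nonneg_right (by linarith) hE0)
    have hd3 : 0 ≤ (1 - p.2)⁻¹ * (Real.exp (-(p.1 * A p.2)) - Real.exp (-p.1)) :=
      mul_nonneg (inv_pos.2 hw1').le (by linarith)
    rw [mul_assoc, norm_mul, Real.norm_of_nonneg hd3, Real.norm_eq_abs]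
    have h1 : |Real.log p.1 + (Real.log p.2 + 1)| ≤ |Real.log p.1| + (|Real.log p.2| + 1) := by
      refine (abs_add_le _ _).trans (add_le_add le_rfl ((abs_add_le _ _).trans ?_))
      simp
    refine (mul_le_mul h1 hd2 hd3 (by positivity)).trans (le_of_eq ?_)
    simp only [Pi.add_apply]
    ring

theorem minStable_cov_SlogS_logT
    {Ω : Type*} [MeasurableSpace Ω] (μ : Measure Ω) [IsProbabilityMeasure μ]
    (S T : Ω → ℝ) (hS : Measurable S) (hT : Measurable T)
    (A : ℝ → ℝ)
    (hAconv : ConvexOn ℝ (Set.Icc (0:ℝ) 1) A)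
    (hAbound : ∀ w ∈ Set.Icc (0:ℝ) 1, max w (1 - w) ≤ A w ∧ A w ≤ 1)
    (hsurv : ∀ x y : ℝ, 0 ≤ x → 0 ≤ y → (x, y) ≠ (0, 0) →
      (μ {ω | x < S ω ∧ y < T ω}).toReal = Real.exp (-((x + y) * A (x / (x + y)))))
    :
    (∫ ω, (S ω * Real.log (S ω)) * Real.log (T ω) ∂μ)
        - (∫ ω, S ω * Real.log (S ω) ∂μ) * (∫ ω, Real.log (T ω) ∂μ)
      = ∫ w in (0:ℝ)..1,
          ((1 - A w) * (Real.log w + deriv Real.Gamma 2 / Real.Gamma 2)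
              - Real.log (A w)) / ((1 - w) * A w) := by
  have hA0 : A 0 = 1 := by
    have := hAbound 0 (by simp)
    exact le_antisymm this.2 (by simpa using this.1)
  have hA1 : A 1 = 1 := by
    have := hAbound 1 (by simp)
    exact le_antisymm this.2 (by simpa using this.1)
  have hx0 : ∀ x : ℝ, 0 < x → μ.real {ω | x < S ω ∧ 0 < T ω} = Real.exp (-x) := by
    intro x hx
    have := hsurv x 0 hx.le le_rfl (by simp [hx.ne'])
    simpa [hx.ne', hA1, measureReal_def] using this
  have h0y : ∀ y : ℝ, 0 < y → μ.real {ω | 0 < S ω ∧ y < T ω} = Real.exp (-y) := by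
    intro y hy
    have := hsurv 0 y le_rfl hy.le (by simp [hy.ne'])
    simpa [hA0, measureReal_def] using this
  have hpos : ∀ᵐ ω ∂μ, 0 < S ω ∧ 0 < T ω := by
    have hm : MeasurableSet {ω | 0 < S ω ∧ 0 < T ω} :=
      (measurableSet_lt measurable_const hS).inter (measurableSet_lt measurable_const hT)
    have hlim : Tendsto (fun x : ℝ => Real.exp (-x)) (nhdsWithin 0 (Set.Ioi 0)) (nhds 1) := by
      have : Continuous fun x : ℝ => Real.exp (-x) := by fun_prop
      simpa using (this.tendsto 0).mono_left nhdsWithin_le_nhds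
    have hge : 1 ≤ μ.real {ω | 0 < S ω ∧ 0 < T ω} := by
      refine le_of_tendsto hlim ?_
      filter_upwards [self_mem_nhdsWithin] with x hx
      have hx : 0 < x := hx
      rw [← hx0 x hx]
      exact measureReal_mono fun ω hω => ⟨hx.trans hω.1, hω.2⟩
    have h1 : μ.real {ω | 0 < S ω ∧ 0 < T ω}ᶜ = 0 := by
      rw [probReal_compl_eq_one_sub hm]
      linarith [measureReal_le_one (μ := μ) (s := {ω | 0 < S ω ∧ 0 < T ω})]
    exact (measureReal_eq_zero_iff).1 h1
  have hSpos : ∀ᵐ ω ∂μ, 0 < S ω := hpos.mono fun _ h => h.1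
  have hTpos : ∀ᵐ ω ∂μ, 0 < T ω := hpos.mono fun _ h => h.2
  have hSs : ∀ x, 0 < x → μ.real {ω | x < S ω} = Real.exp (-x) := by
    intro x hx
    rw [← hx0 x hx]
    refine measureReal_congr (hTpos.mono fun ω h => ?_)
    exact propext ⟨fun h' => ⟨h', h⟩, fun h' => h'.1⟩
  have hTs : ∀ y, 0 < y → μ.real {ω | y < T ω} = Real.exp (-y) := by
    intro y hy
    rw [← h0y y hy]
    refine measureReal_congr (hSpos.mono fun ω h => ?_)
    exact propext ⟨fun h' => ⟨h, h'⟩, fun h' => h'.2⟩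
  obtain ⟨hint, hcov⟩ := cov_mul_log_log_eq_integral hS hT hSpos hTpos
    (map_eq_expMeasure hS hSpos hSs) (map_eq_expMeasure hT hTpos hTs)
  have hzero : ∀ p : ℝ × ℝ, ¬(0 < p.1 ∧ 0 < p.2) → (Real.log p.1 + 1) * p.2⁻¹ *
      (μ.real {ω | p.1 < S ω ∧ p.2 < T ω}
        - μ.real {ω | p.1 < S ω} * μ.real {ω | p.2 < T ω}) = 0 := by
    intro p hp
    rcases not_and_or.1 hp with h | h
    · have e1 : μ.real {ω | p.1 < S ω} = 1 := by
        rw [measureReal_def, (mem_ae_iff_prob_eq_one (measurableSet_lt measurable_const hS)).1,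
          ENNReal.toReal_one]
        filter_upwards [hSpos] with ω h' using (not_lt.1 h).trans_lt h'
      have e2 : μ.real {ω | p.1 < S ω ∧ p.2 < T ω} = μ.real {ω | p.2 < T ω} := by
        refine measureReal_congr (hSpos.mono fun ω h' => ?_)
        exact propext ⟨fun h2 => h2.2, fun h2 => ⟨(not_lt.1 h).trans_lt h', h2⟩⟩
      rw [e1, e2]; ring
    · have e1 : μ.real {ω | p.2 < T ω} = 1 := by
        rw [measureReal_def, (mem_ae_iff_prob_eq_one (measurableSet_lt measurable_const hT)).1,
          ENNReal.toReal_one]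
        filter_upwards [hTpos] with ω h' using (not_lt.1 h).trans_lt h'
      have e2 : μ.real {ω | p.1 < S ω ∧ p.2 < T ω} = μ.real {ω | p.1 < S ω} := by
        refine measureReal_congr (hTpos.mono fun ω h' => ?_)
        exact propext ⟨fun h2 => h2.1, fun h2 => ⟨h2, (not_lt.1 h).trans_lt h'⟩⟩
      rw [e1, e2]; ring
  have hcont : ContinuousOn A (Set.Ioo 0 1) := by
    simpa using hAconv.continuousOn_interior
  have hradial : ∀ r ∈ Set.Ioi (0 : ℝ), (∫ w in Set.Ioo (0 : ℝ) 1,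
      r * ((Real.log (r * w) + 1) * (r * (1 - w))⁻¹ *
        (μ.real {ω | r * w < S ω ∧ r * (1 - w) < T ω}
          - μ.real {ω | r * w < S ω} * μ.real {ω | r * (1 - w) < T ω})))
      = ∫ w in Set.Ioo (0 : ℝ) 1, (Real.log r + (Real.log w + 1)) * (1 - w)⁻¹ *
        (Real.exp (-(r * A w)) - Real.exp (-r)) := by
    intro r hr
    have hr : 0 < r := hr
    refine setIntegral_congr_fun measurableSet_Ioo fun w hw => ?_
    have hw0 : 0 < w := hw.1
    have hw1 : 0 < 1 - w := by linarith [hw.2]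
    have e1 : μ.real {ω | r * w < S ω ∧ r * (1 - w) < T ω} = Real.exp (-(r * A w)) := by
      have := hsurv (r * w) (r * (1 - w)) (by positivity) (by positivity) (by
        intro h
        exact (mul_pos hr hw0).ne' (congrArg Prod.fst h))
      rw [measureReal_def, this, show r * w + r * (1 - w) = r by ring,
        mul_div_cancel_left₀ _ hr.ne']
    have e2 : Real.exp (-(r * w)) * Real.exp (-(r * (1 - w))) = Real.exp (-r) := by
      rw [← Real.exp_add]; ring_nf
    rw [e1, hSs _ (mul_pos hr hw0), hTs _ (mul_pos hr hw1), e2, Real.log_mul hr.ne' hw0.ne']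
    field_simp
    ring
  rw [hcov, integral_eq_integral_radial hint hzero, setIntegral_congr_fun measurableSet_Ioi hradial,
    integral_integral_swap (integrable_radial hcont hAbound),
    intervalIntegral.integral_of_le zero_le_one, integral_Ioc_eq_integral_Ioo]
  refine setIntegral_congr_fun measurableSet_Ioo fun w hw => ?_
  have hw1 : 0 < 1 - w := by linarith [hw.2]
  obtain ⟨hb1, -⟩ := hAbound w ⟨hw.1.le, hw.2.le⟩
  have hAw : 0 < A w := hw.1.trans_le ((le_max_left _ _).trans hb1)
  have e : (fun r => (Real.log r + (Real.log w + 1)) * (1 - w)⁻¹ *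
      (Real.exp (-(r * A w)) - Real.exp (-r)))
      = fun r => (1 - w)⁻¹ * ((Real.log r + (Real.log w + 1)) *
      (Real.exp (-(r * A w)) - Real.exp (-r))) := by
    ext r; ring
  simp only [e]
  rw [integral_const_mul, integral_log_add_mul_exp_sub hAw, deriv_Gamma_two_div]
  field_simp
  ring
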